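/- arXiv:1407.6686 — 5 statements merged into one kernel-verified Lean document; each statement's English description precedes it below -/
import Mathlib

section
/- Let Y, Z, ξ ∈ ℝ^{1+n} with η(Y,Y) > 0, η(Z,Z) > 0, η(Y,Z) > 0 (i.e. Y and Z are timelike and lie in the same time cone) and ξ ≠ 0. Then η(Y,ξ)·η(Z,ξ) − (1/2)·η(Y,Z)·η(ξ,ξ) > 0. -/
/-- The Minkowski bilinear form on `ℝ^{1+n}`:
`η(v,w) = v₀w₀ − ∑_{i=1}^{n} vᵢwᵢ`. -/
def minkowski {n : ℕ} (v w : Fin (n + 1) → ℝ) : ℝ :=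
  v 0 * w 0 - ∑ i : Fin n, v i.succ * w i.succ

theorem minkowski_comm {n : ℕ} (v w : Fin (n + 1) → ℝ) : minkowski v w = minkowski w v := by
  simp only [minkowski, mul_comm]

theorem minkowski_smul_sub_smul_left {n : ℕ} (a b : ℝ) (u v w : Fin (n + 1) → ℝ) :
    minkowski (a • u - b • v) w = a * minkowski u w - b * minkowski v w := by
  simp only [minkowski, Pi.sub_apply, Pi.smul_apply, smul_eq_mul, sub_mul, mul_assoc,
    Finset.sum_sub_distrib, ← Finset.mul_sum]
  ring

theorem minkowski_smul_sub_smul_right {n : ℕ} (a b : ℝ) (u v w : Fin (n + 1) → ℝ) :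
    minkowski w (a • u - b • v) = a * minkowski w u - b * minkowski w v := by
  rw [minkowski_comm, minkowski_smul_sub_smul_left, minkowski_comm u, minkowski_comm v]

/-- A nonzero vector orthogonal to a timelike vector is spacelike. -/
theorem minkowski_self_neg_of_orthogonal {n : ℕ} {Y v : Fin (n + 1) → ℝ}
    (hY : 0 < minkowski Y Y) (h : minkowski Y v = 0) (hv : v ≠ 0) : minkowski v v < 0 := by
  have hcs := Finset.sum_mul_sq_le_sq_mul_sq Finset.univ
    (fun i : Fin n => Y i.succ) (fun i : Fin n => v i.succ)
  simp only [minkowski, ← pow_two] at hY h ⊢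
  have hY0 : 0 < Y 0 ^ 2 := by
    have : 0 ≤ ∑ i : Fin n, Y i.succ ^ 2 := Finset.sum_nonneg fun i _ => sq_nonneg _
    linarith
  have hnn : 0 ≤ ∑ i : Fin n, v i.succ ^ 2 := Finset.sum_nonneg fun i _ => sq_nonneg _
  rw [← sub_eq_zero.mp h] at hcs
  rcases hnn.eq_or_lt with h0 | hpos
  · have hs : ∀ i : Fin n, v i.succ = 0 := fun i =>
      sq_eq_zero_iff.mp <|
        (Finset.sum_eq_zero_iff_of_nonneg fun i _ => sq_nonneg (v i.succ)).mp h0.symm i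
          (Finset.mem_univ i)
    have hv0 : v 0 = 0 := by
      simpa [hs, sq_pos_iff.mp hY0] using h
    exact absurd (funext fun i => Fin.cases hv0 hs i) hv
  · have hlt := mul_lt_mul_of_pos_right (sub_pos.mp hY) hpos
    have : Y 0 ^ 2 * v 0 ^ 2 < Y 0 ^ 2 * ∑ i : Fin n, v i.succ ^ 2 := by
      rw [← mul_pow]
      exact hcs.trans_lt hlt
    exact sub_neg.mpr (lt_of_mul_lt_mul_left this hY0.le)

theorem minkowski_self_nonpos_of_orthogonal {n : ℕ} {Y v : Fin (n + 1) → ℝ}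
    (hY : 0 < minkowski Y Y) (h : minkowski Y v = 0) : minkowski v v ≤ 0 := by
  rcases eq_or_ne v 0 with rfl | hv
  · simp [minkowski]
  · exact (minkowski_self_neg_of_orthogonal hY h hv).le

/-- The reverse Cauchy–Schwarz inequality. -/
theorem minkowski_self_mul_self_le_sq {n : ℕ} {Y : Fin (n + 1) → ℝ}
    (hY : 0 < minkowski Y Y) (v : Fin (n + 1) → ℝ) :
    minkowski Y Y * minkowski v v ≤ minkowski Y v ^ 2 := by
  have h := minkowski_self_nonpos_of_orthogonal hY
    (v := minkowski Y Y • v - minkowski Y v • Y)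
    (by rw [minkowski_smul_sub_smul_right]; ring)
  simp only [minkowski_smul_sub_smul_left, minkowski_smul_sub_smul_right,
    minkowski_comm v Y] at h
  refine sub_nonpos.mp (nonpos_of_mul_nonpos_right (a := minkowski Y Y) ?_ hY)
  linarith

/-- A timelike and a causal vector in the same time cone have positive product. -/
theorem minkowski_pos_of_same_cone {n : ℕ} {Y Z W : Fin (n + 1) → ℝ}
    (hY : 0 < minkowski Y Y) (hZ : 0 < minkowski Z Z) (hW : 0 ≤ minkowski W W)
    (hYZ : 0 < minkowski Y Z) (hYW : 0 < minkowski Y W) : 0 < minkowski Z W := by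
  have h := minkowski_self_nonpos_of_orthogonal hY
    (v := minkowski Y W • Z - minkowski Y Z • W)
    (by rw [minkowski_smul_sub_smul_right]; ring)
  simp only [minkowski_smul_sub_smul_left, minkowski_smul_sub_smul_right,
    minkowski_comm W Z] at h
  have h1 : 0 < minkowski Y W ^ 2 * minkowski Z Z := by positivity
  have h2 : 0 ≤ minkowski Y Z ^ 2 * minkowski W W := by positivity
  refine pos_of_mul_pos_right (a := minkowski Y W * minkowski Y Z) ?_ (by positivity)
  linarith

/-- Positivity of the stress-energy tensor: if `Y`, `Z` are timelike and in the
same time cone and `ξ ≠ 0`, then `η(Y,ξ)η(Z,ξ) − ½η(Y,Z)η(ξ,ξ) > 0`. -/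
theorem stress_energy_positive (n : ℕ) (hn : 1 ≤ n)
    (Y Z ξ : Fin (n + 1) → ℝ) (hY : 0 < minkowski Y Y) (hZ : 0 < minkowski Z Z)
    (hYZ : 0 < minkowski Y Z) (hξ : ξ ≠ 0) :
    0 < minkowski Y ξ * minkowski Z ξ - (1 / 2) * minkowski Y Z * minkowski ξ ξ := by
  have hYW : 0 < minkowski Y ((2 * minkowski Y ξ) • ξ - minkowski ξ ξ • Y) := by
    rw [minkowski_smul_sub_smul_right]
    have hcs := minkowski_self_mul_self_le_sq hY ξ
    rcases eq_or_ne (minkowski Y ξ) 0 with h0 | h0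
    · have := mul_neg_of_neg_of_pos (minkowski_self_neg_of_orthogonal hY h0 hξ) hY
      rw [h0]
      linarith
    · have := sq_pos_iff.mpr h0
      linarith
  have hWW : 0 ≤ minkowski ((2 * minkowski Y ξ) • ξ - minkowski ξ ξ • Y)
      ((2 * minkowski Y ξ) • ξ - minkowski ξ ξ • Y) := by
    have : 0 ≤ minkowski ξ ξ ^ 2 * minkowski Y Y := by positivity
    simp only [minkowski_smul_sub_smul_left, minkowski_smul_sub_smul_right, minkowski_comm ξ Y]
    linarith
  have h := minkowski_pos_of_same_cone hY hZ hWW hYZ hYW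
  rw [minkowski_smul_sub_smul_right, minkowski_comm Z Y] at h
  linarith
end

section
/- Let a ∈ ℝ with a² < 1, let M > 0, and set Δ_r(r) = (r² + a²)(1 + r²) − 2Mr and Δ_θ(θ) = 1 − a²cos²θ. Fix r ∈ ℝ and θ ∈ (0,π). Then the quadratic form q(ξ_r, ξ_θ, ξ_φ) = Δ_r(r)·ξ_r² + 2a(1 − a²)·ξ_r·ξ_φ + Δ_θ(θ)·ξ_θ² + ((1 − a²)²/(Δ_θ(θ)·sin²θ))·ξ_φ² on ℝ³ is positive definite if and only if Δ_r(r) > a²·Δ_θ(θ)·sin²θ. -/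
open Real

/-- A quadratic form with a single cross term `2 a k x z` and `z`-coefficient `k² / D` is
positive definite iff its `x`-coefficient exceeds `a² D`. -/
theorem forall_pos_quadratic_iff {a k A T D : ℝ} (hk : 0 < k) (hT : 0 < T) (hD : 0 < D) :
    (∀ x y z : ℝ, (x, y, z) ≠ (0, 0, 0) →
      0 < A * x ^ 2 + 2 * a * k * x * z + T * y ^ 2 + k ^ 2 / D * z ^ 2) ↔ a ^ 2 * D < A := by
  have complete_square (x y z : ℝ) :
      A * x ^ 2 + 2 * a * k * x * z + T * y ^ 2 + k ^ 2 / D * z ^ 2 =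
        (A - a ^ 2 * D) * x ^ 2 + T * y ^ 2 + (k * z + a * D * x) ^ 2 / D := by
    field_simp
    ring
  simp only [complete_square]
  constructor
  · intro h
    have h1 := h 1 0 (-(a * D) / k) (by simp)
    have hz : k * (-(a * D) / k) + a * D * 1 = 0 := by
      field_simp
      ring
    rw [hz] at h1
    norm_num at h1
    exact h1
  · intro h x y z hxyz
    have hA : 0 < A - a ^ 2 * D := sub_pos.mpr h
    by_cases hx : x = 0
    · by_cases hy : y = 0
      · have hz : z ≠ 0 := by
          rintro rfl
          exact hxyz (by rw [hx, hy])
        subst hx hy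
        simp only [mul_zero, add_zero]
        positivity
      · positivity
    · positivity

/-- The principal symbol `σ₂(P)` of the stationary Klein–Gordon operator on
Kerr–AdS (units `l = 1`) is positive definite at a point with coordinates
`(r, θ)`, `θ ∈ (0,π)`, if and only if `Δ_r > a²Δ_θ sin²θ` there. -/
theorem kerrAdS_symbol_positive_definite_iff (a M r θ : ℝ)
    (ha : a ^ 2 < 1) (hM : 0 < M) (hθ : θ ∈ Set.Ioo 0 π) :
    (∀ ξr ξθ ξφ : ℝ, (ξr, ξθ, ξφ) ≠ (0, 0, 0) →
      0 < ((r ^ 2 + a ^ 2) * (1 + r ^ 2) - 2 * M * r) * ξr ^ 2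
          + 2 * a * (1 - a ^ 2) * ξr * ξφ
          + (1 - a ^ 2 * cos θ ^ 2) * ξθ ^ 2
          + (1 - a ^ 2) ^ 2 / ((1 - a ^ 2 * cos θ ^ 2) * sin θ ^ 2) * ξφ ^ 2) ↔
    a ^ 2 * (1 - a ^ 2 * cos θ ^ 2) * sin θ ^ 2
      < (r ^ 2 + a ^ 2) * (1 + r ^ 2) - 2 * M * r := by
  have hsin : 0 < sin θ := sin_pos_of_mem_Ioo hθ
  have hT : 0 < 1 - a ^ 2 * cos θ ^ 2 := by
    nlinarith [mul_le_of_le_one_right (sq_nonneg a) (cos_sq_le_one θ)]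
  rw [mul_assoc (a ^ 2)]
  exact forall_pos_quadratic_iff (sub_pos.mpr ha) hT (by positivity)
end

section
/- Let a ∈ ℝ with a² < 1 and M > 0, and on the phase space {(r,θ,φ,ξ_r,ξ_θ,ξ_φ) : θ ∈ (0,π)} define p = Δ_r(r)·ξ_r² + 2a(1 − a²)·ξ_r·ξ_φ + Δ_θ(θ)·ξ_θ² + ((1 − a²)²/(Δ_θ(θ)·sin²θ))·ξ_φ² and p₁ = Δ_θ(θ)·ξ_θ² + ((1 − a²)²/(Δ_θ(θ)·sin²θ))·ξ_φ². Then the Poisson bracket of p and p₁ vanishes identically: {p, p₁} = 0; that is, p₁ is a constant of motion of the Hamiltonian flow of p. -/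
open Real

/-- The principal symbol `p` of the stationary Klein–Gordon operator on a
Kerr–AdS black hole (units `l = 1`), as a function of
`(r, θ, φ, ξr, ξθ, ξφ)`. -/
noncomputable def kerrSymbol (a M : ℝ) (r θ φ ξr ξθ ξφ : ℝ) : ℝ :=
  ((r ^ 2 + a ^ 2) * (1 + r ^ 2) - 2 * M * r) * ξr ^ 2
    + 2 * a * (1 - a ^ 2) * ξr * ξφ
    + (1 - a ^ 2 * cos θ ^ 2) * ξθ ^ 2
    + (1 - a ^ 2) ^ 2 / ((1 - a ^ 2 * cos θ ^ 2) * sin θ ^ 2) * ξφ ^ 2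

/-- The angular part `p₁` of the symbol. -/
noncomputable def kerrAngularSymbol (a : ℝ) (r θ φ ξr ξθ ξφ : ℝ) : ℝ :=
  (1 - a ^ 2 * cos θ ^ 2) * ξθ ^ 2
    + (1 - a ^ 2) ^ 2 / ((1 - a ^ 2 * cos θ ^ 2) * sin θ ^ 2) * ξφ ^ 2

/-- The Poisson bracket `{f,g} = ∑_{x ∈ {r,θ,φ}} (∂_{ξ_x}f ∂_x g − ∂_x f ∂_{ξ_x}g)`
of two functions on the phase space `ℝ³_{(r,θ,φ)} × ℝ³_{(ξr,ξθ,ξφ)}`. -/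
noncomputable def poissonBracket (f g : ℝ → ℝ → ℝ → ℝ → ℝ → ℝ → ℝ)
    (r θ φ ξr ξθ ξφ : ℝ) : ℝ :=
  deriv (fun x => f r θ φ x ξθ ξφ) ξr * deriv (fun x => g x θ φ ξr ξθ ξφ) r
    - deriv (fun x => f x θ φ ξr ξθ ξφ) r * deriv (fun x => g r θ φ x ξθ ξφ) ξr
    + deriv (fun x => f r θ φ ξr x ξφ) ξθ * deriv (fun x => g r x φ ξr ξθ ξφ) θ
    - deriv (fun x => f r x φ ξr ξθ ξφ) θ * deriv (fun x => g r θ φ ξr x ξφ) ξθ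
    + deriv (fun x => f r θ φ ξr ξθ x) ξφ * deriv (fun x => g r θ x ξr ξθ ξφ) φ
    - deriv (fun x => f r θ x ξr ξθ ξφ) φ * deriv (fun x => g r θ φ ξr ξθ x) ξφ

/-- The symbol `p` is `p₁` plus a part that does not involve `θ` and `ξθ`. -/
lemma kerrSymbol_eq_add_kerrAngularSymbol (a M r θ φ ξr ξθ ξφ : ℝ) :
    kerrSymbol a M r θ φ ξr ξθ ξφ =
      (((r ^ 2 + a ^ 2) * (1 + r ^ 2) - 2 * M * r) * ξr ^ 2 + 2 * a * (1 - a ^ 2) * ξr * ξφ)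
        + kerrAngularSymbol a r θ φ ξr ξθ ξφ := by
  simp only [kerrSymbol, kerrAngularSymbol]
  ring

/-- `p₁` is a constant of motion for the Hamiltonian flow of `p`: the Poisson
bracket `{p, p₁}` vanishes identically on `{θ ∈ (0,π)}`. -/
theorem kerrAngularSymbol_conserved (a M : ℝ) (ha : a ^ 2 < 1) (hM : 0 < M) :
    ∀ r θ φ ξr ξθ ξφ : ℝ, θ ∈ Set.Ioo 0 π →
      poissonBracket (kerrSymbol a M) (kerrAngularSymbol a) r θ φ ξr ξθ ξφ = 0 := by
  intro r θ φ ξr ξθ ξφ _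
  have hξθ : deriv (fun x => kerrSymbol a M r θ φ ξr x ξφ) ξθ =
      deriv (fun x => kerrAngularSymbol a r θ φ ξr x ξφ) ξθ := by
    simp only [kerrSymbol_eq_add_kerrAngularSymbol, deriv_const_add]
  have hθ : deriv (fun x => kerrSymbol a M r x φ ξr ξθ ξφ) θ =
      deriv (fun x => kerrAngularSymbol a r x φ ξr ξθ ξφ) θ := by
    simp only [kerrSymbol_eq_add_kerrAngularSymbol, deriv_const_add]
  have hφ : deriv (fun x => kerrSymbol a M r θ x ξr ξθ ξφ) φ = 0 := deriv_const _ _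
  have gr : deriv (fun x => kerrAngularSymbol a x θ φ ξr ξθ ξφ) r = 0 := deriv_const _ _
  have gφ : deriv (fun x => kerrAngularSymbol a r θ x ξr ξθ ξφ) φ = 0 := deriv_const _ _
  have gξr : deriv (fun x => kerrAngularSymbol a r θ φ x ξθ ξφ) ξr = 0 := deriv_const _ _
  rw [poissonBracket, hξθ, hθ, hφ, gr, gφ, gξr]
  ring
end

section
/- Let a ∈ ℝ with a² < 1 and M > 0, and on the phase space {(r,θ,φ,ξ_r,ξ_θ,ξ_φ) : θ ∈ (0,π), ξ_r ≠ 0} define p = Δ_r(r)·ξ_r² + 2a(1 − a²)·ξ_r·ξ_φ + Δ_θ(θ)·ξ_θ² + ((1 − a²)²/(Δ_θ(θ)·sin²θ))·ξ_φ² and p₁ = Δ_θ(θ)·ξ_θ² + ((1 − a²)²/(Δ_θ(θ)·sin²θ))·ξ_φ². Then the Poisson bracket of p with the homogeneous degree-zero function p₁/ξ_r² satisfies the exact identity {p, p₁/ξ_r²} = 2·(∂_rΔ_r)(r)·ξ_r·(p₁/ξ_r²). -/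
open Real

lemma deriv_kerrSymbol_r (a M r θ φ ξr ξθ ξφ : ℝ) :
    deriv (fun x => kerrSymbol a M x θ φ ξr ξθ ξφ) r =
      deriv (fun s : ℝ => (s ^ 2 + a ^ 2) * (1 + s ^ 2) - 2 * M * s) r * ξr ^ 2 := by
  simp only [kerrSymbol, deriv_add_const, deriv_mul_const_field]

lemma deriv_kerrSymbol_θ (a M r θ φ ξr ξθ ξφ : ℝ) :
    deriv (fun x => kerrSymbol a M r x φ ξr ξθ ξφ) θ =
      deriv (fun x => kerrAngularSymbol a r x φ ξr ξθ ξφ) θ := by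
  simp only [kerrSymbol_eq_add_kerrAngularSymbol, deriv_const_add]

lemma deriv_kerrSymbol_ξθ (a M r θ φ ξr ξθ ξφ : ℝ) :
    deriv (fun x => kerrSymbol a M r θ φ ξr x ξφ) ξθ =
      deriv (fun x => kerrAngularSymbol a r θ φ ξr x ξφ) ξθ := by
  simp only [kerrSymbol_eq_add_kerrAngularSymbol, deriv_const_add]

lemma deriv_const_div_sq (c : ℝ) {x : ℝ} (hx : x ≠ 0) :
    deriv (fun y : ℝ => c / y ^ 2) x = -2 * c / x ^ 3 := by
  have h := (hasDerivAt_const x c).fun_div (hasDerivAt_pow 2 x) (pow_ne_zero 2 hx)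
  rw [h.deriv]
  field_simp
  ring

/-- The exact source/sink identity at the radial sets:
`{p, p₁/ξr²} = 2(∂_rΔ_r)(r)·ξr·(p₁/ξr²)` on `{θ ∈ (0,π), ξr ≠ 0}`. -/
theorem kerrSymbol_radial_source_sink (a M : ℝ) (ha : a ^ 2 < 1) (hM : 0 < M) :
    ∀ r θ φ ξr ξθ ξφ : ℝ, θ ∈ Set.Ioo 0 π → ξr ≠ 0 →
      poissonBracket (kerrSymbol a M)
          (fun r' θ' φ' ξr' ξθ' ξφ' => kerrAngularSymbol a r' θ' φ' ξr' ξθ' ξφ' / ξr' ^ 2)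
          r θ φ ξr ξθ ξφ
        = 2 * deriv (fun s : ℝ => (s ^ 2 + a ^ 2) * (1 + s ^ 2) - 2 * M * s) r * ξr
            * (kerrAngularSymbol a r θ φ ξr ξθ ξφ / ξr ^ 2) := by
  intro r θ φ ξr ξθ ξφ _ hξr
  have hr : deriv (fun x => kerrAngularSymbol a x θ φ ξr ξθ ξφ / ξr ^ 2) r = 0 := by
    simp only [kerrAngularSymbol, deriv_const]
  have hφ : deriv (fun x => kerrAngularSymbol a r θ x ξr ξθ ξφ / ξr ^ 2) φ = 0 := by
    simp only [kerrAngularSymbol, deriv_const]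
  have hpφ : deriv (fun x => kerrSymbol a M r θ x ξr ξθ ξφ) φ = 0 := by
    simp only [kerrSymbol, deriv_const]
  have hξ : deriv (fun x => kerrAngularSymbol a r θ φ x ξθ ξφ / x ^ 2) ξr =
      -2 * kerrAngularSymbol a r θ φ ξr ξθ ξφ / ξr ^ 3 :=
    deriv_const_div_sq (kerrAngularSymbol a r θ φ ξr ξθ ξφ) hξr
  simp only [poissonBracket, hr, hφ, hpφ, hξ, deriv_kerrSymbol_r, deriv_kerrSymbol_θ,
    deriv_kerrSymbol_ξθ, deriv_div_const]
  generalize deriv (fun s : ℝ => (s ^ 2 + a ^ 2) * (1 + s ^ 2) - 2 * M * s) r = D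
  field_simp
  ring
end

section
/- Let c > 0 and C > 0, and let f : [0,∞) → ℝ be continuously differentiable with f(t) ≥ 0 for all t ≥ 0, f(0) < (c/C)², and f′(t) ≤ −2c·f(t) + C·f(t)^{3/2} for all t ≥ 0. Then f(t) ≤ f(0)·e^{−ct} for all t ≥ 0; in particular f(t) → 0 as t → ∞. -/
open Set

/-- For `0 < x < (c/C)²` the superlinear term `C x^{3/2}` is strictly dominated by `c x`. -/
theorem const_mul_rpow_three_halves_lt {c C x : ℝ} (hc : 0 < c) (hC : 0 < C) (hx : 0 < x)
    (hlt : x < (c / C) ^ 2) : C * x ^ ((3 : ℝ) / 2) < c * x := by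
  have hpow : x ^ ((3 : ℝ) / 2) = x * √x := by
    rw [show (3 : ℝ) / 2 = 1 + 1 / 2 by norm_num, Real.rpow_add hx, Real.rpow_one,
      ← Real.sqrt_eq_rpow]
  have hsqrt : √x < c / C := (Real.sqrt_lt' (by positivity)).2 hlt
  rw [lt_div_iff₀ hC] at hsqrt
  rw [hpow]
  nlinarith

/-- Any exponential starting strictly between `f 0` and `(c/C)²` is a barrier for the differential
inequality `f′ ≤ −2cf + Cf^{3/2}`. -/
theorem le_mul_exp_of_differential_inequality {c C K : ℝ} (hc : 0 < c) (hC : 0 < C)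
    {f f' : ℝ → ℝ}
    (hderiv : ∀ t ∈ Ici (0 : ℝ), HasDerivWithinAt f (f' t) (Ici 0) t)
    (hineq : ∀ t ∈ Ici (0 : ℝ), f' t ≤ -2 * c * f t + C * f t ^ ((3 : ℝ) / 2))
    (hK : 0 < K) (h0 : f 0 ≤ K) (hKlt : K < (c / C) ^ 2) {t : ℝ} (ht : 0 ≤ t) :
    f t ≤ K * Real.exp (-c * t) := by
  have hB (x : ℝ) :
      HasDerivAt (fun y => K * Real.exp (-c * y)) (K * (Real.exp (-c * x) * -c)) x := by
    simpa using (((hasDerivAt_id x).const_mul (-c)).exp).const_mul K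
  refine image_le_of_deriv_right_lt_deriv_boundary (f := f) (f' := f') (a := 0) (b := t)
    (fun x hx => (hderiv x hx.1).continuousWithinAt.mono Icc_subset_Ici_self)
    (fun x hx => (hderiv x hx.1).mono (Ici_subset_Ici.2 hx.1))
    (by simpa using h0) hB (fun x hx hfx => ?_) ⟨ht, le_rfl⟩
  have hle : Real.exp (-c * x) ≤ 1 := Real.exp_le_one_iff.2 (by nlinarith [hx.1])
  have hpos : 0 < f x := by rw [hfx]; positivity
  have hlt : f x < (c / C) ^ 2 := by rw [hfx]; nlinarith
  have hsuper := const_mul_rpow_three_halves_lt hc hC hpos hlt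
  linarith [hineq x hx.1, congrArg (c * ·) hfx]

/-- Quantitative decay for the differential inequality `f′ ≤ −2cf + Cf^{3/2}`:
if `f ≥ 0` is continuously differentiable on `[0,∞)` with `f(0) < (c/C)²`, then
`f(t) ≤ f(0)e^{−ct}` for all `t ≥ 0`; in particular `f(t) → 0` as `t → ∞`. -/
theorem decay_of_differential_inequality (c C : ℝ) (hc : 0 < c) (hC : 0 < C)
    (f f' : ℝ → ℝ)
    (hderiv : ∀ t ∈ Ici (0 : ℝ), HasDerivWithinAt f (f' t) (Ici 0) t)
    (hcont : ContinuousOn f' (Ici 0))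
    (hnn : ∀ t ∈ Ici (0 : ℝ), 0 ≤ f t)
    (h0 : f 0 < (c / C) ^ 2)
    (hineq : ∀ t ∈ Ici (0 : ℝ), f' t ≤ -2 * c * f t + C * f t ^ ((3 : ℝ) / 2)) :
    (∀ t ∈ Ici (0 : ℝ), f t ≤ f 0 * Real.exp (-c * t)) ∧
    Filter.Tendsto f Filter.atTop (nhds 0) := by
  have hdecay : ∀ t ∈ Ici (0 : ℝ), f t ≤ f 0 * Real.exp (-c * t) := by
    intro t ht
    by_contra! hlt
    rw [← lt_div_iff₀ (Real.exp_pos _)] at hlt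
    obtain ⟨K, hK, hKlt⟩ := exists_between (lt_min hlt h0)
    have hle := le_mul_exp_of_differential_inequality hc hC hderiv hineq
      ((hnn 0 self_mem_Ici).trans_lt hK) hK.le (hKlt.trans_le (min_le_right _ _)) ht
    rw [← div_le_iff₀ (Real.exp_pos _)] at hle
    exact (hKlt.trans_le (min_le_left _ _)).not_ge hle
  refine ⟨hdecay, ?_⟩
  have hexp : Filter.Tendsto (fun t => f 0 * Real.exp (-c * t)) Filter.atTop (nhds 0) := by
    simpa using (Real.tendsto_exp_atBot.comp
      (Filter.tendsto_id.const_mul_atTop_of_neg (neg_lt_zero.2 hc))).const_mul (f 0)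
  refine tendsto_of_tendsto_of_tendsto_of_le_of_le' tendsto_const_nhds hexp ?_ ?_
  · filter_upwards [Filter.eventually_ge_atTop 0] with t ht using hnn t ht
  · filter_upwards [Filter.eventually_ge_atTop 0] with t ht using hdecay t ht
end
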